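/- With the fixed-pair setup in a diregular (2,k,+3)-digraph with k ≥ 4: N^+(u₁) ∩ N^+(v₁) ≠ ∅, i.e. u₁ and v₁ have at least one common out-neighbour. -/

import Mathlib

/-- `p` is a directed walk from `u` to `v` in the digraph with arc relation `A`,
recorded as the list of its vertices; a walk of length `l` (i.e. with `l` arcs)
is a list of `l + 1` vertices. -/
def IsWalkFrom {V : Type*} (A : V → V → Prop) (u v : V) (p : List V) : Prop :=
  p.Chain' A ∧ p.head? = some u ∧ p.getLast? = some v

/-- A digraph is `k`-geodetic if for every ordered pair of vertices `(u, v)`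
there is at most one directed path of length at most `k` from `u` to `v`. -/
def IsKGeodetic {V : Type*} (A : V → V → Prop) (k : ℕ) : Prop :=
  ∀ (u v : V) (p q : List V), IsWalkFrom A u v p → IsWalkFrom A u v q →
    p.length ≤ k + 1 → q.length ≤ k + 1 → p = q

/-- `Nout A u = N⁺(u)`, the set of out-neighbours of `u`. -/
def Nout {V : Type*} (A : V → V → Prop) (u : V) : Set V := {v | A u v}

/-- `Nin A u = N⁻(u)`, the set of in-neighbours of `u`. -/
def Nin {V : Type*} (A : V → V → Prop) (u : V) : Set V := {v | A v u}

/-- `NIter A l u = N^l(u)`, the set of vertices reachable from `u` by a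
directed path of length exactly `l`. -/
def NIter {V : Type*} (A : V → V → Prop) (l : ℕ) (u : V) : Set V :=
  {v | ∃ p : List V, IsWalkFrom A u v p ∧ p.length = l + 1}

/-- `Ball A l u = T_l(u) = N^0(u) ∪ N^1(u) ∪ ⋯ ∪ N^l(u)`, the set of vertices
at distance at most `l` from `u`. -/
def Ball {V : Type*} (A : V → V → Prop) (l : ℕ) (u : V) : Set V :=
  {v | ∃ m ≤ l, v ∈ NIter A m u}

/-- `Outliers A k u = O(u) = {v | d(u,v) ≥ k + 1}`, the outlier set of `u`. -/
def Outliers {V : Type*} (A : V → V → Prop) (k : ℕ) (u : V) : Set V :=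
  {v | v ∉ Ball A k u}

/-- A digraph is diregular with degree `d` if every vertex has out-degree `d`
and in-degree `d`. -/
def IsDiregular {V : Type*} (A : V → V → Prop) (d : ℕ) : Prop :=
  ∀ u : V, (Nout A u).ncard = d ∧ (Nin A u).ncard = d

/-- The Moore bound `M(d,k) = 1 + d + d² + ⋯ + d^k`. -/
def moore (d k : ℕ) : ℕ := ∑ i ∈ Finset.range (k + 1), d ^ i

/-- `Reach A n x y`: there is a directed walk of length exactly `n` from `x` to `y`. -/
def Reach {V : Type*} (A : V → V → Prop) : ℕ → V → V → Prop
  | 0, x, y => x = y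
  | n + 1, x, y => ∃ z, A x z ∧ Reach A n z y

namespace Reach

variable {V : Type*} {A : V → V → Prop} {k m n : ℕ} {x y z w : V}

theorem single (h : A x y) : Reach A 1 x y := ⟨y, h, rfl⟩

theorem trans (h : Reach A m x y) (h' : Reach A n y z) : Reach A (m + n) x z := by
  induction m generalizing x with
  | zero => cases h; simpa using h'
  | succ m ih =>
    obtain ⟨w, hw, h⟩ := h
    rw [Nat.succ_add]
    exact ⟨w, hw, ih h⟩

theorem split (h : Reach A (m + n) x z) : ∃ y, Reach A m x y ∧ Reach A n y z := by
  induction m generalizing x with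
  | zero => exact ⟨x, rfl, by simpa using h⟩
  | succ m ih =>
    rw [Nat.succ_add] at h
    obtain ⟨w, hw, h⟩ := h
    obtain ⟨y, hy, h⟩ := ih h
    exact ⟨y, ⟨w, hw, hy⟩, h⟩

theorem exists_walk (h : Reach A n x y) : ∃ p, IsWalkFrom A x y p ∧ p.length = n + 1 := by
  induction n generalizing x with
  | zero => cases h; exact ⟨[y], ⟨List.isChain_singleton y, rfl, rfl⟩, rfl⟩
  | succ n ih =>
    obtain ⟨z, hz, h⟩ := h
    obtain ⟨p, ⟨hc, hh, hl⟩, hp⟩ := ih h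
    obtain _ | ⟨a, p⟩ := p
    · simp at hp
    · obtain rfl : a = z := by simpa using hh
      refine ⟨x :: a :: p, ⟨List.isChain_cons_cons.2 ⟨hz, hc⟩, rfl, ?_⟩, by simpa using hp⟩
      simpa using hl

theorem length_unique (hg : IsKGeodetic A k) (h : Reach A m x y) (h' : Reach A n x y)
    (hm : m ≤ k) (hn : n ≤ k) : m = n := by
  obtain ⟨p, hp, hpl⟩ := h.exists_walk
  obtain ⟨q, hq, hql⟩ := h'.exists_walk
  have := hg x y p q hp hq (by omega) (by omega)
  subst this
  omega

theorem first_unique (hg : IsKGeodetic A k) (hz : A x z) (hw : A x w) (h : Reach A m z y)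
    (h' : Reach A n w y) (hm : m < k) (hn : n < k) : z = w := by
  obtain ⟨p, hp, hpl⟩ := h.exists_walk
  obtain ⟨q, hq, hql⟩ := h'.exists_walk
  have key : ∀ {a p}, A x a → IsWalkFrom A a y p → IsWalkFrom A x y (x :: p) := by
    rintro a p ha ⟨hc, hh, hl⟩
    obtain _ | ⟨b, p⟩ := p
    · simp at hh
    · obtain rfl : b = a := by simpa using hh
      exact ⟨List.isChain_cons_cons.2 ⟨ha, hc⟩, rfl, by simpa using hl⟩
  have := hg x y _ _ (key hz hp) (key hw hq) (by simp; omega) (by simp; omega)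
  obtain rfl : p = q := by simpa using this
  simpa using hp.2.1.symm.trans hq.2.1

theorem middle_unique (hg : IsKGeodetic A k) (h₁ : Reach A m x z) (h₂ : Reach A m x w)
    (h₃ : Reach A n z y) (h₄ : Reach A n w y) (hk : m + n ≤ k) : z = w := by
  induction m generalizing x with
  | zero => exact h₁.symm.trans h₂
  | succ m ih =>
    obtain ⟨a, ha, h₁⟩ := h₁
    obtain ⟨b, hb, h₂⟩ := h₂
    obtain rfl := first_unique hg ha hb (h₁.trans h₃) (h₂.trans h₄) (by omega) (by omega)
    exact ih h₁ h₂ (by omega)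

theorem ne_of_length_ne (hg : IsKGeodetic A k) (h : Reach A m x y) (h' : Reach A n x z)
    (hmn : m ≠ n) (hm : m ≤ k) (hn : n ≤ k) : y ≠ z := by
  rintro rfl
  exact hmn (length_unique hg h h' hm hn)

end Reach

section Levels

open Classical

theorem four_le_card {V : Type*} {s : Finset V} {a b c d : V} (ha : a ∈ s) (hb : b ∈ s) (hc : c ∈ s)
    (hd : d ∈ s) (hab : a ≠ b) (hac : a ≠ c) (had : a ≠ d) (hbc : b ≠ c) (hbd : b ≠ d)
    (hcd : c ≠ d) : 4 ≤ s.card := by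
  have : ({a, b, c, d} : Finset V) ⊆ s := by
    simp [Finset.insert_subset_iff, ha, hb, hc, hd]
  have h := Finset.card_le_card this
  have h4 : ({a, b, c, d} : Finset V).card = 4 := by
    simp [Finset.card_insert_of_notMem, hab, hac, had, hbc, hbd, hcd]
  omega

variable {V : Type*} [Fintype V] {A : V → V → Prop} {k n : ℕ} {x y : V}

/-- The vertices reachable from `x` by a walk of length exactly `n`. -/
noncomputable def level (A : V → V → Prop) (n : ℕ) (x : V) : Finset V :=
  Finset.univ.filter (Reach A n x)

/-- The outlier set of `x` as a finset. -/
noncomputable def outlierFinset (A : V → V → Prop) (k : ℕ) (x : V) : Finset V :=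
  Finset.univ.filter fun y => ∀ m ≤ k, ¬ Reach A m x y

@[simp] theorem mem_level : y ∈ level A n x ↔ Reach A n x y := by simp [level]

@[simp] theorem mem_outlierFinset :
    y ∈ outlierFinset A k x ↔ ∀ m ≤ k, ¬ Reach A m x y := by simp [outlierFinset]

theorem mem_level_one : y ∈ level A 1 x ↔ A x y := by
  simp [Reach]

theorem card_level_one (hreg : IsDiregular A 2) (x : V) : (level A 1 x).card = 2 := by
  rw [← (hreg x).1, ← Set.ncard_coe_finset]
  congr 1
  ext y
  rw [Finset.mem_coe, mem_level_one]
  rfl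

theorem card_level (hreg : IsDiregular A 2) (hg : IsKGeodetic A k) (hn : n ≤ k) (x : V) :
    (level A n x).card = 2 ^ n := by
  induction n generalizing x with
  | zero =>
    have : level A 0 x = {x} := by ext y; simp [Reach, eq_comm]
    simp [this]
  | succ n ih =>
    have : level A (n + 1) x = (level A 1 x).biUnion (level A n) := by
      ext y
      rw [Finset.mem_biUnion, mem_level]
      simp only [mem_level_one]
      simp only [mem_level]
      rfl
    rw [this, Finset.card_biUnion, Finset.sum_congr rfl fun z _ => ih (by omega) z]
    · simp [card_level_one hreg, pow_succ, mul_comm]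
    · intro z hz w hw hzw
      refine Finset.disjoint_left.2 fun y hy hy' => hzw ?_
      rw [Finset.mem_coe, mem_level_one] at hz hw
      exact Reach.first_unique hg hz hw (mem_level.1 hy) (mem_level.1 hy') hn hn

theorem card_outlierFinset (hreg : IsDiregular A 2) (hg : IsKGeodetic A k) {ε : ℕ}
    (hcard : Fintype.card V = moore 2 k + ε) (x : V) : (outlierFinset A k x).card = ε := by
  have hball : ((Finset.range (k + 1)).biUnion fun m => level A m x).card = moore 2 k := by
    rw [Finset.card_biUnion]
    · exact Finset.sum_congr rfl fun m hm =>
        card_level hreg hg (by simpa [Nat.lt_succ_iff] using hm) x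
    · intro m hm n hn hmn
      simp only [Finset.coe_range, Set.mem_Iio, Nat.lt_succ_iff] at hm hn
      exact Finset.disjoint_left.2 fun y hy hy' =>
        hmn (Reach.length_unique hg (mem_level.1 hy) (mem_level.1 hy') hm hn)
  have hcompl : outlierFinset A k x =
      ((Finset.range (k + 1)).biUnion fun m => level A m x)ᶜ := by
    ext y
    simp
  rw [hcompl, Finset.card_compl, hball, hcard]
  omega

theorem exists_two_arcs (hreg : IsDiregular A 2) (x : V) : ∃ y z, y ≠ z ∧ A x y ∧ A x z := by
  obtain ⟨y, z, h, he⟩ := Finset.card_eq_two.1 (card_level_one hreg x)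
  exact ⟨y, z, h, mem_level_one.1 (by simp [he]), mem_level_one.1 (by simp [he])⟩

theorem exists_other_arc (hreg : IsDiregular A 2) (x y : V) : ∃ z, z ≠ y ∧ A x z := by
  obtain ⟨a, b, h, ha, hb⟩ := exists_two_arcs hreg x
  by_cases hay : a = y
  · exact ⟨b, fun hby => h (hay.trans hby.symm), hb⟩
  · exact ⟨a, hay, ha⟩

end Levels

/-- A diregular `(2,k,+3)`-digraph with `k ≥ 4`, together with vertices `u`, `v` having exactly one
common out-neighbour `u₂`. -/
structure FixedPair {V : Type*} [Fintype V] (A : V → V → Prop) (k : ℕ) (u v u₁ u₂ v₁ : V) :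
    Prop where
  reg : IsDiregular A 2
  geo : IsKGeodetic A k
  card : Fintype.card V = moore 2 k + 3
  four_le : 4 ≤ k
  arc_left : ∀ x, A u x ↔ x = u₁ ∨ x = u₂
  arc_right : ∀ x, A v x ↔ x = v₁ ∨ x = u₂
  ne_left : u₁ ≠ u₂
  ne_right : v₁ ≠ u₂
  ne : u₁ ≠ v₁

namespace FixedPair

open Classical

variable {V : Type*} [Fintype V] {A : V → V → Prop} {k s t : ℕ} {u v u₁ u₂ v₁ w x y : V}

theorem symm (h : FixedPair A k u v u₁ u₂ v₁) : FixedPair A k v u v₁ u₂ u₁ :=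
  ⟨h.reg, h.geo, h.card, h.four_le, h.arc_right, h.arc_left, h.ne_right, h.ne_left, h.ne.symm⟩

theorem reach_left (h : FixedPair A k u v u₁ u₂ v₁) (hs : Reach A s u₁ y) :
    Reach A (s + 1) u y := ⟨u₁, (h.arc_left _).2 (.inl rfl), hs⟩

theorem reach_right (h : FixedPair A k u v u₁ u₂ v₁) (hs : Reach A s v₁ y) :
    Reach A (s + 1) v y := h.symm.reach_left hs

theorem card_outlier (h : FixedPair A k u v u₁ u₂ v₁) : (outlierFinset A k u).card = 3 :=
  card_outlierFinset h.reg h.geo h.card u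

theorem not_reach_self (h : FixedPair A k u v u₁ u₂ v₁) (hs : Reach A s x x) (h0 : 0 < s)
    (hk : s ≤ k) : False := by
  have := Reach.length_unique h.geo hs (n := 0) rfl hk (by omega)
  omega

/-- A vertex within distance `k - 1` of `v₁` is `u`, an outlier of `u`, or is close to `u₁`. -/
theorem trichotomy (h : FixedPair A k u v u₁ u₂ v₁) (hs : Reach A s v₁ y) (hk : s < k) :
    y = u ∨ y ∈ outlierFinset A k u ∨ ∃ t < k, Reach A t u₁ y := by
  by_cases hy : y ∈ outlierFinset A k u
  · exact .inr (.inl hy)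
  · simp only [mem_outlierFinset, not_forall, not_not] at hy
    obtain ⟨_ | m, hm, hy⟩ := hy
    · exact .inl hy.symm
    · obtain ⟨z, hz, hy⟩ := hy
      obtain rfl | rfl := (h.arc_left z).1 hz
      · exact .inr (.inr ⟨m, hm, hy⟩)
      · exact absurd (Reach.first_unique h.geo ((h.arc_right _).2 (.inl rfl))
          ((h.arc_right _).2 (.inr rfl)) hs hy hk hm) h.ne_right

theorem not_reach_base (h : FixedPair A k u v u₁ u₂ v₁) (hs : Reach A s v₁ u) (hk : s + 2 ≤ k) :
    False := by
  have h2 : Reach A 1 u u₂ := .single ((h.arc_left _).2 (.inr rfl))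
  have h3 : Reach A 1 v u₂ := .single ((h.arc_right _).2 (.inr rfl))
  have := Reach.length_unique h.geo (h.reach_right (hs.trans h2)) h3 hk (by omega)
  omega

theorem level_subset (h : FixedPair A k u v u₁ u₂ v₁) (hs : Reach A s v₁ w)
    (ht : Reach A t u₁ w) (hst : s < t) (htk : t < k) :
    level A (k - t) w ⊆ insert u (outlierFinset A k u) := by
  intro y hy
  rw [mem_level] at hy
  rw [Finset.mem_insert]
  obtain hyu | hyo | ⟨r, hr, hyr⟩ := h.trichotomy (hs.trans hy) (by omega)
  · exact .inl hyu
  · exact .inr hyo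
  · have := Reach.length_unique h.geo (ht.trans hy) hyr (by omega) (by omega)
    omega

theorem card_insert_le (h : FixedPair A k u v u₁ u₂ v₁) :
    (insert u (outlierFinset A k u)).card ≤ 4 := by
  have := Finset.card_insert_le u (outlierFinset A k u)
  rwa [h.card_outlier] at this

theorem le_two_of_pow_le {n : ℕ} (h : 2 ^ n ≤ 4) : n ≤ 2 := by
  by_contra hn
  have := Nat.pow_le_pow_right (n := 2) (by norm_num) (show 3 ≤ n by omega)
  omega

theorem right_mem_outlier_or (h : FixedPair A k u v u₁ u₂ v₁) :
    v₁ ∈ outlierFinset A k u ∨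
      (Reach A (k - 1) u₁ v₁ ∧ ∀ x, A v₁ x → x ∈ outlierFinset A k u) := by
  have hk := h.four_le
  obtain hu | ho | ⟨t, ht, hr⟩ := h.trichotomy (s := 0) rfl (by omega)
  · exact (h.not_reach_base (s := 0) hu (by omega)).elim
  · exact .inl ho
  · right
    obtain _ | t := t
    · exact absurd hr h.ne
    have hsub := h.level_subset (s := 0) rfl hr (by omega) ht
    have hc := (Finset.card_le_card hsub).trans h.card_insert_le
    rw [card_level h.reg h.geo (by omega)] at hc
    have h2 := le_two_of_pow_le hc
    have hsub' : level A (k - (t + 1)) v₁ ⊆ outlierFinset A k u := by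
      intro y hy
      obtain rfl | hy' := Finset.mem_insert.1 (hsub hy)
      · exact (h.not_reach_base (mem_level.1 hy) (by omega)).elim
      · exact hy'
    have hc := Finset.card_le_card hsub'
    rw [card_level h.reg h.geo (by omega), h.card_outlier] at hc
    have h1 : k - (t + 1) = 1 := by
      have : k - (t + 1) ≠ 2 := by rintro h; rw [h] at hc; omega
      omega
    rw [h1] at hsub'
    refine ⟨?_, fun x hx => hsub' (mem_level_one.2 hx)⟩
    rwa [show k - 1 = t + 1 by omega]

theorem not_reach_left (h : FixedPair A k u v u₁ u₂ v₁) (hs : Reach A s v₁ u₁)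
    (hk : s + 1 < k) : False := by
  obtain ho | ⟨hr, -⟩ := h.symm.right_mem_outlier_or
  · exact mem_outlierFinset.1 ho _ hk.le (h.reach_right hs)
  · have := Reach.length_unique h.geo hs hr (by omega) (by omega)
    omega

theorem mem_outlier_or_arcs (h : FixedPair A k u v u₁ u₂ v₁)
    (hdisj : ∀ x, A u₁ x → A v₁ x → False) (hv : v₁ ∈ outlierFinset A k u) (hx : A v₁ x) :
    x ∈ outlierFinset A k u ∨ ∀ y, A x y → y ∈ outlierFinset A k u := by
  have hk := h.four_le
  obtain rfl | ho | ⟨t, ht, hr⟩ := h.trichotomy (.single hx) (by omega)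
  · exact (h.not_reach_base (.single hx) (by omega)).elim
  · exact .inl ho
  · right
    obtain _ | _ | t := t
    · cases hr
      exact (h.not_reach_left (.single hx) (by omega)).elim
    · obtain ⟨_, hz, rfl⟩ := hr
      exact (hdisj _ hz hx).elim
    have hsub := h.level_subset (.single hx) hr (by omega) ht
    have hc := (Finset.card_le_card hsub).trans h.card_insert_le
    rw [card_level h.reg h.geo (by omega)] at hc
    have h2 := le_two_of_pow_le hc
    have hnv : v₁ ∉ level A (k - (t + 1 + 1)) x := fun hm =>
      h.not_reach_self ((Reach.single hx).trans (mem_level.1 hm)) (by omega) (by omega)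
    have hsub' : insert v₁ (level A (k - (t + 1 + 1)) x) ⊆ insert u (outlierFinset A k u) :=
      Finset.insert_subset (Finset.mem_insert_of_mem hv) hsub
    have hc := (Finset.card_le_card hsub').trans h.card_insert_le
    rw [Finset.card_insert_of_notMem hnv, card_level h.reg h.geo (by omega)] at hc
    have h1 : k - (t + 1 + 1) = 1 := by
      have : k - (t + 1 + 1) ≠ 2 := by rintro h; rw [h] at hc; omega
      omega
    rw [h1] at hsub
    intro y hy
    obtain rfl | hy' := Finset.mem_insert.1 (hsub (mem_level_one.2 hy))
    · exact (h.not_reach_base ((Reach.single hx).trans (.single hy)) (by omega)).elim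
    · exact hy'

theorem arc_mem_outlier (h : FixedPair A k u v u₁ u₂ v₁)
    (hdisj : ∀ x, A u₁ x → A v₁ x → False) (hx : A v₁ x) : x ∈ outlierFinset A k u := by
  have hk := h.four_le
  obtain hv | ⟨-, hv⟩ := h.right_mem_outlier_or
  swap
  · exact hv x hx
  by_contra hxo
  have hxs := (h.mem_outlier_or_arcs hdisj hv hx).resolve_left hxo
  obtain ⟨y, hyx, hy⟩ := exists_other_arc h.reg v₁ x
  obtain ⟨a, b, hab, ha, hb⟩ := exists_two_arcs h.reg x
  have hlev : ∀ {n : ℕ} {z : V}, Reach A n v₁ z → n ≠ 0 → n ≤ k → v₁ ≠ z := fun hz h0 hn =>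
    Reach.ne_of_length_ne h.geo (m := 0) rfl hz h0.symm (by omega) hn
  have ha2 : Reach A 2 v₁ a := ⟨x, hx, .single ha⟩
  have hb2 : Reach A 2 v₁ b := ⟨x, hx, .single hb⟩
  have hcard := h.card_outlier
  obtain hyo | hys := h.mem_outlier_or_arcs hdisj hv hy
  · have := four_le_card hv hyo (hxs a ha) (hxs b hb) (hlev (.single hy) (by omega) (by omega))
      (hlev ha2 (by omega) (by omega)) (hlev hb2 (by omega) (by omega))
      (Reach.ne_of_length_ne h.geo (.single hy) ha2 (by omega) (by omega) (by omega))
      (Reach.ne_of_length_ne h.geo (.single hy) hb2 (by omega) (by omega) (by omega)) hab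
    omega
  · obtain ⟨c, -, -, hc, -⟩ := exists_two_arcs h.reg y
    have hc2 : Reach A 2 v₁ c := ⟨y, hy, .single hc⟩
    have hne : ∀ {z}, A x z → c ≠ z := by
      rintro z hz rfl
      exact hyx (Reach.first_unique h.geo hy hx (.single hc) (.single hz) (by omega) (by omega))
    have := four_le_card hv (hys c hc) (hxs a ha) (hxs b hb) (hlev hc2 (by omega) (by omega))
      (hlev ha2 (by omega) (by omega)) (hlev hb2 (by omega) (by omega)) (hne ha) (hne hb) hab
    omega

/-- Each vertex at distance two from `v₁` is at distance two from `u₁`, an outlier of `u`, or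
an in-neighbour of `u` at distance three from `u₁` (and then `k = 4`). -/
theorem second_level_cases (h : FixedPair A k u v u₁ u₂ v₁)
    (hdisj : ∀ x, A u₁ x → A v₁ x → False) (hw : Reach A 2 v₁ w) :
    Reach A 2 u₁ w ∨ w ∈ outlierFinset A k u ∨
      (k = 4 ∧ Reach A 3 u₁ w ∧ A w u ∧ ∀ y, A w y → y = u ∨ y ∈ outlierFinset A k u) := by
  have hk := h.four_le
  obtain rfl | ho | ⟨t, ht, hr⟩ := h.trichotomy hw (by omega)
  · exact (h.not_reach_base hw (by omega)).elim
  · exact .inr (.inl ho)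
  · obtain _ | _ | _ | t := t
    · cases hr
      exact (h.not_reach_left hw (by omega)).elim
    · obtain ⟨_, hz, rfl⟩ := hr
      have := h.symm.arc_mem_outlier (fun x hx hx' => hdisj x hx' hx) hz
      exact (mem_outlierFinset.1 this 3 (by omega) (h.reach_right hw)).elim
    · exact .inl hr
    right; right
    have hsub := h.level_subset hw hr (by omega) ht
    obtain ⟨p, q, hpq, hp, hq⟩ := exists_two_arcs h.reg v₁
    have hpo := h.arc_mem_outlier hdisj hp
    have hqo := h.arc_mem_outlier hdisj hq
    have hne : ∀ {z}, A v₁ z → z ∉ level A (k - (t + 1 + 1 + 1)) w := fun {z} hz hm =>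
      Reach.ne_of_length_ne h.geo (Reach.single hz) (hw.trans (mem_level.1 hm))
        (by omega) (by omega) (by omega) rfl
    have hsub' : insert p (insert q (level A (k - (t + 1 + 1 + 1)) w)) ⊆
        insert u (outlierFinset A k u) :=
      Finset.insert_subset (Finset.mem_insert_of_mem hpo)
        (Finset.insert_subset (Finset.mem_insert_of_mem hqo) hsub)
    have hc := (Finset.card_le_card hsub').trans h.card_insert_le
    rw [Finset.card_insert_of_notMem (by simpa [hpq] using hne hp),
      Finset.card_insert_of_notMem (hne hq), card_level h.reg h.geo (by omega)] at hc
    have h1 : k - (t + 1 + 1 + 1) = 1 := by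
      have h2 := le_two_of_pow_le (n := k - (t + 1 + 1 + 1)) (by omega)
      have : k - (t + 1 + 1 + 1) ≠ 2 := by rintro h; rw [h] at hc; omega
      omega
    rw [h1] at hsub
    have hsub1 : ∀ y, A w y → y = u ∨ y ∈ outlierFinset A k u := fun y hy =>
      Finset.mem_insert.1 (hsub (mem_level_one.2 hy))
    have hwu : A w u := by
      by_contra hwu
      obtain ⟨a, b, hab, ha, hb⟩ := exists_two_arcs h.reg w
      have hmem : ∀ {z}, A w z → z ∈ outlierFinset A k u := fun {z} hz =>
        (hsub1 z hz).resolve_left (by rintro rfl; exact hwu hz)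
      have hd : ∀ {y z}, A v₁ y → A w z → y ≠ z := fun hy hz =>
        Reach.ne_of_length_ne h.geo (.single hy) (hw.trans (.single hz))
          (by omega) (by omega) (by omega)
      have := four_le_card hpo hqo (hmem ha) (hmem hb) hpq (hd hp ha) (hd hp hb) (hd hq ha)
        (hd hq hb) hab
      have := h.card_outlier
      omega
    have hk4 : k = 4 := by
      by_contra hk4
      exact h.not_reach_base (hw.trans (.single hwu)) (by omega)
    refine ⟨hk4, ?_, hwu, hsub1⟩
    rwa [show 3 = t + 1 + 1 + 1 by omega]

/-- At most one vertex at distance two from `v₁` is not at distance two from `u₁`. -/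
theorem exceptional_unique (h : FixedPair A k u v u₁ u₂ v₁)
    (hdisj : ∀ x, A u₁ x → A v₁ x → False) (hw : Reach A 2 v₁ w) (hx : Reach A 2 v₁ x)
    (hw' : ¬ Reach A 2 u₁ w) (hx' : ¬ Reach A 2 u₁ x) : w = x := by
  have hk := h.four_le
  obtain ⟨p, q, hpq, hp, hq⟩ := exists_two_arcs h.reg v₁
  have hpo := h.arc_mem_outlier hdisj hp
  have hqo := h.arc_mem_outlier hdisj hq
  have hcard := h.card_outlier
  have hd : ∀ {n y z}, A v₁ y → Reach A n v₁ z → 1 ≠ n → n ≤ k → y ≠ z := fun hy hz h1 hn =>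
    Reach.ne_of_length_ne h.geo (.single hy) hz h1 (by omega) hn
  have mixed : ∀ {a b}, Reach A 2 v₁ a → Reach A 2 v₁ b → a ∈ outlierFinset A k u →
      (∀ y, A b y → y = u ∨ y ∈ outlierFinset A k u) → False := by
    intro a b ha hb hao hbo
    obtain ⟨y, hyu, hy⟩ := exists_other_arc h.reg b u
    have hy3 : Reach A 3 v₁ y := hb.trans (.single hy)
    have := four_le_card hpo hqo hao ((hbo y hy).resolve_left hyu) hpq
      (hd hp ha (by omega) (by omega)) (hd hp hy3 (by omega) (by omega))
      (hd hq ha (by omega) (by omega)) (hd hq hy3 (by omega) (by omega))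
      (Reach.ne_of_length_ne h.geo ha hy3 (by omega) (by omega) (by omega))
    omega
  obtain hwo | ⟨-, -, hwu, hws⟩ := (h.second_level_cases hdisj hw).resolve_left hw' <;>
    obtain hxo | ⟨-, -, hxu, hxs⟩ := (h.second_level_cases hdisj hx).resolve_left hx'
  · by_contra hwx
    have := four_le_card hpo hqo hwo hxo hpq (hd hp hw (by omega) (by omega))
      (hd hp hx (by omega) (by omega)) (hd hq hw (by omega) (by omega))
      (hd hq hx (by omega) (by omega)) hwx
    omega
  · exact (mixed hw hx hwo hxs).elim
  · exact (mixed hx hw hxo hws).elim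
  · exact Reach.middle_unique h.geo hw hx (.single hwu) (.single hxu) (by omega)

/-- If `u` or `u₁` is not an outlier of `v`, then it is reached from `v₁` through a vertex at
distance two from `v₁` that is not at distance two from `u₁`. -/
theorem reach_exceptional (h : FixedPair A k u v u₁ u₂ v₁)
    (hy : y = u ∨ y = u₁) (hyo : y ∉ outlierFinset A k v) :
    ∃ w, Reach A 2 v₁ w ∧ ¬ Reach A 2 u₁ w ∧ Reach A (k - 3) w y := by
  have hk := h.four_le
  have hr : Reach A (k - 1) v₁ y := by
    obtain rfl | rfl := hy
    · simp only [mem_outlierFinset, not_forall, not_not] at hyo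
      obtain ⟨m, hm, hr⟩ := hyo
      obtain _ | m := m
      · cases hr
        exact (h.ne (((h.arc_right _).1 ((h.arc_left _).2 (.inl rfl))).resolve_right
          h.ne_left)).elim
      · obtain ⟨z, hz, hr⟩ := hr
        obtain rfl | rfl := (h.arc_right z).1 hz
        · have : m = k - 1 := by
            by_contra hne
            exact h.not_reach_base hr (by omega)
          rwa [← this]
        · exact (h.not_reach_self (hr.trans (.single ((h.arc_left _).2 (.inr rfl))))
            (by omega) (by omega)).elim
    · exact (h.symm.right_mem_outlier_or.resolve_left hyo).1
  rw [show k - 1 = 2 + (k - 3) by omega] at hr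
  obtain ⟨w, hw, hr⟩ := hr.split
  refine ⟨w, hw, fun hw' => ?_, hr⟩
  obtain rfl | rfl := hy
  · exact h.not_reach_self (h.reach_left (hw'.trans hr)) (by omega) (by omega)
  · exact h.not_reach_self (hw'.trans hr) (by omega) (by omega)

theorem left_or_base_mem_outlier (h : FixedPair A k u v u₁ u₂ v₁)
    (hdisj : ∀ x, A u₁ x → A v₁ x → False) :
    u ∈ outlierFinset A k v ∨ u₁ ∈ outlierFinset A k v := by
  by_contra! hcon
  have hk := h.four_le
  obtain ⟨w, hw, hw', hwu⟩ := h.reach_exceptional (.inl rfl) hcon.1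
  obtain ⟨x, hx, hx', hxu⟩ := h.reach_exceptional (.inr rfl) hcon.2
  obtain rfl := h.exceptional_unique hdisj hw hx hw' hx'
  have := Reach.length_unique h.geo (hwu.trans (.single ((h.arc_left _).2 (.inl rfl)))) hxu
    (by omega) (by omega)
  omega

theorem exceptional_not_mem_outlier (h : FixedPair A k u v u₁ u₂ v₁)
    (hdisj : ∀ x, A u₁ x → A v₁ x → False) (hw : Reach A 2 u₁ w) :
    w ∉ outlierFinset A k v := by
  intro hwo
  have hk := h.four_le
  have hdisj' : ∀ x, A v₁ x → A u₁ x → False := fun x hx hx' => hdisj x hx' hx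
  obtain ⟨p, q, hpq, hp, hq⟩ := exists_two_arcs h.reg u₁
  have hpo := h.symm.arc_mem_outlier hdisj' hp
  have hqo := h.symm.arc_mem_outlier hdisj' hq
  have hcard := h.symm.card_outlier
  have hd : ∀ {l m y z}, Reach A l u y → Reach A m u z → l ≠ m → l ≤ k → m ≤ k → y ≠ z :=
    fun hy hz => Reach.ne_of_length_ne h.geo hy hz
  have hp2 := h.reach_left (.single hp)
  have hq2 := h.reach_left (.single hq)
  have hw3 := h.reach_left hw
  have key : ∀ {n y}, Reach A n u y → n < 2 → y ∉ outlierFinset A k v := by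
    intro n y hn hn2 hyo
    have := four_le_card hyo hpo hqo hwo (hd hn hp2 (by omega) (by omega) (by omega))
      (hd hn hq2 (by omega) (by omega) (by omega)) (hd hn hw3 (by omega) (by omega) (by omega))
      hpq (hd hp2 hw3 (by omega) (by omega) (by omega))
      (hd hq2 hw3 (by omega) (by omega) (by omega))
    omega
  obtain ho | ho := h.left_or_base_mem_outlier hdisj
  · exact key (n := 0) rfl (by omega) ho
  · exact key (.single ((h.arc_left _).2 (.inl rfl))) (by omega) ho

theorem exists_exceptional (h : FixedPair A k u v u₁ u₂ v₁)
    (hdisj : ∀ x, A u₁ x → A v₁ x → False) : ∃ w, Reach A 2 v₁ w ∧ ¬ Reach A 2 u₁ w := by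
  have hk := h.four_le
  by_cases huo : u ∈ outlierFinset A k v
  · by_cases huo' : u₁ ∈ outlierFinset A k v
    · have hdisj' : ∀ x, A v₁ x → A u₁ x → False := fun x hx hx' => hdisj x hx' hx
      obtain ⟨p, q, hpq, hp, hq⟩ := exists_two_arcs h.reg u₁
      have hpo := h.symm.arc_mem_outlier hdisj' hp
      have hqo := h.symm.arc_mem_outlier hdisj' hq
      have hcard := h.symm.card_outlier
      have hd : ∀ {l m y z}, Reach A l u y → Reach A m u z → l ≠ m → l ≤ k → m ≤ k → y ≠ z :=
        fun hy hz => Reach.ne_of_length_ne h.geo hy hz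
      have hu1 : Reach A 1 u u₁ := h.reach_left (s := 0) rfl
      have hp2 := h.reach_left (.single hp)
      have hq2 := h.reach_left (.single hq)
      have := four_le_card huo huo' hpo hqo
        (hd (l := 0) rfl hu1 (by omega) (by omega) (by omega))
        (hd (l := 0) rfl hp2 (by omega) (by omega) (by omega))
        (hd (l := 0) rfl hq2 (by omega) (by omega) (by omega))
        (hd hu1 hp2 (by omega) (by omega) (by omega))
        (hd hu1 hq2 (by omega) (by omega) (by omega)) hpq
      omega
    · obtain ⟨w, hw, hw', -⟩ := h.reach_exceptional (.inr rfl) huo'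
      exact ⟨w, hw, hw'⟩
  · obtain ⟨w, hw, hw', -⟩ := h.reach_exceptional (.inl rfl) huo
    exact ⟨w, hw, hw'⟩

theorem not_disjoint (h : FixedPair A k u v u₁ u₂ v₁)
    (hdisj : ∀ x, A u₁ x → A v₁ x → False) : False := by
  have hk := h.four_le
  have hdisj' : ∀ x, A v₁ x → A u₁ x → False := fun x hx hx' => hdisj x hx' hx
  obtain ⟨w, hw, hw'⟩ := h.exists_exceptional hdisj
  obtain ⟨-, hw3, -, -⟩ := ((h.second_level_cases hdisj hw).resolve_left hw').resolve_left
    (h.symm.exceptional_not_mem_outlier hdisj' hw)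
  obtain ⟨x, hx, hxw⟩ := Reach.split (m := 2) (n := 1) hw3
  by_cases hx' : Reach A 2 v₁ x
  · have := Reach.length_unique h.geo hw (hx'.trans hxw) (by omega) (by omega)
    omega
  obtain ⟨-, -, -, hxs⟩ := ((h.symm.second_level_cases hdisj' hx).resolve_left hx').resolve_left
    (h.exceptional_not_mem_outlier hdisj hx)
  obtain ⟨_, hz, rfl⟩ := hxw
  obtain rfl | ho := hxs _ hz
  · exact h.not_reach_self (h.reach_right hw) (by omega) (by omega)
  · exact mem_outlierFinset.1 ho 3 (by omega) (h.reach_right hw)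

end FixedPair

/-- Fixed-pair setup, `k ≥ 4`: `u₁` and `v₁` have at least one common
out-neighbour. -/
theorem neighbourhoods_not_disjoint {V : Type*} [Fintype V] (A : V → V → Prop) (k : ℕ)
    (u v u₁ u₂ v₁ : V)
    (hirr : Irreflexive A) (hreg : IsDiregular A 2) (hgeo : IsKGeodetic A k)
    (hcard : Fintype.card V = moore 2 k + 3)
    (hu : Nout A u = {u₁, u₂}) (hv : Nout A v = {v₁, u₂}) (huv : u₁ ≠ v₁)
    (hk : 4 ≤ k) :
    (Nout A u₁ ∩ Nout A v₁).Nonempty := by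
  have hne : ∀ {a b c : V}, Nout A a = {b, c} → b ≠ c := by
    rintro a b c ha rfl
    have := (hreg a).1
    simp [ha] at this
  by_contra hcon
  refine (FixedPair.mk (u := u) (v := v) hreg hgeo hcard hk (fun x => ?_) (fun x => ?_) (hne hu) (hne hv)
    huv).not_disjoint fun x hx hx' => hcon ⟨x, hx, hx'⟩
  · simpa [Nout] using Set.ext_iff.1 hu x
  · simpa [Nout] using Set.ext_iff.1 hv x
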